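/- (One Very Fast Runner) Let n ≥ 2 and let v₁ < v₂ < ⋯ < v_{n−1} be positive integers with ML(v₁, …, v_{n−1}) = L, and fix a real number ε with 0 < ε < L. Then for any positive integer vₙ with vₙ ≥ ((L − ε)/ε)·v_{n−1}, one has ML(v₁, …, v_{n−1}, vₙ) ≥ L − ε. -/

import Mathlib

/-- `dnn x` is the distance from `x` to the nearest integer:
`dnn x = min_{m : ℤ} |x - m|`. -/
noncomputable def dnn (x : ℝ) : ℝ := ⨅ m : ℤ, |x - m|

/-- The maximum loneliness of speeds `v 0, …, v (n-1)`:
`ML v = sup_{t : ℝ} min_{i} dnn (t * v i)`. -/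
noncomputable def ML {n : ℕ} (v : Fin n → ℝ) : ℝ := ⨆ t : ℝ, ⨅ i, dnn (t * v i)

lemma dnn_bdd (x : ℝ) : BddBelow (Set.range fun m : ℤ => |x - m|) :=
  ⟨0, by rintro _ ⟨m, rfl⟩; exact abs_nonneg _⟩

lemma dnn_le_half (x : ℝ) : dnn x ≤ 1 / 2 :=
  (ciInf_le (dnn_bdd x) (round x)).trans (abs_sub_round x)

lemma dnn_lip (x y : ℝ) : dnn x - |x - y| ≤ dnn y := by
  refine le_ciInf fun m => ?_
  have h1 : dnn x ≤ |x - m| := ciInf_le (dnn_bdd x) m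
  have h2 := abs_sub_le x y m
  linarith

lemma dnn_ge (y c : ℝ) (m : ℤ) (h1 : m + c ≤ y) (h2 : y ≤ m + 1 - c) : c ≤ dnn y := by
  refine le_ciInf fun k => ?_
  rcases le_or_gt k m with h | h
  · have : (k : ℝ) ≤ m := by exact_mod_cast h
    exact le_trans (by linarith) (le_abs_self _)
  · have : (m : ℝ) + 1 ≤ k := by exact_mod_cast h
    exact le_trans (by linarith) (neg_le_abs _)

lemma exists_near (x c : ℝ) (h0 : 0 ≤ c) (hc : c ≤ 1 / 2) : ∃ y, |x - y| ≤ c ∧ c ≤ dnn y := by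
  have h1 := Int.floor_le x
  have h2 := Int.lt_floor_add_one x
  by_cases ha : x < ⌊x⌋ + c
  · exact ⟨⌊x⌋ + c, by rw [abs_le]; constructor <;> linarith,
      dnn_ge _ _ ⌊x⌋ (by linarith) (by linarith)⟩
  · by_cases hb : ⌊x⌋ + 1 - c < x
    · exact ⟨⌊x⌋ + 1 - c, by rw [abs_le]; constructor <;> linarith,
        dnn_ge _ _ ⌊x⌋ (by linarith) (by linarith)⟩
    · exact ⟨x, by simpa using h0, dnn_ge _ _ ⌊x⌋ (by linarith) (by linarith)⟩

lemma inf_le_half {n : ℕ} (i : Fin n) (v : Fin n → ℝ) (t : ℝ) :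
    ⨅ i, dnn (t * v i) ≤ 1 / 2 :=
  (ciInf_le (Set.finite_range _).bddBelow i).trans (dnn_le_half _)

theorem stmt_12 (n : ℕ) (hn : 2 ≤ n) (v : Fin (n - 1) → ℕ)
    (hpos : ∀ i, 0 < v i) (hmono : StrictMono v) (L ε : ℝ)
    (hL : ML (fun i => (v i : ℝ)) = L) (hε₀ : 0 < ε) (hεL : ε < L)
    (vn : ℕ) (hvn : 0 < vn)
    (hfast : ((L - ε) / ε) * (v ⟨n - 2, by omega⟩ : ℝ) ≤ (vn : ℝ)) :
    ML (fun i : Fin n =>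
        if h : (i : ℕ) < n - 1 then (v ⟨(i : ℕ), h⟩ : ℝ) else (vn : ℝ)) ≥ L - ε := by
  have hLhalf : L ≤ 1 / 2 := by
    rw [← hL]
    exact ciSup_le fun t => inf_le_half ⟨0, by omega⟩ _ t
  refine le_of_forall_pos_le_add fun δ hδ => ?_
  obtain ⟨t₀, ht₀⟩ : ∃ t : ℝ, L - δ < ⨅ i, dnn (t * (v i : ℝ)) := by
    apply exists_lt_of_lt_ciSup
    change L - δ < ML (fun i => (v i : ℝ))
    linarith
  have hvn' : (0 : ℝ) < vn := by exact_mod_cast hvn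
  obtain ⟨y, hy1, hy2⟩ := exists_near (t₀ * vn) (L - ε) (by linarith) (by linarith)
  have hty : y / vn * vn = y := by field_simp
  have hd : |t₀ - y / vn| * vn ≤ L - ε := by
    rw [← abs_of_pos hvn', ← abs_mul, abs_of_pos hvn', sub_mul, hty]
    exact hy1
  have hV : (0 : ℝ) < v ⟨n - 2, by omega⟩ := by exact_mod_cast hpos _
  have hdV : |t₀ - y / vn| * v ⟨n - 2, by omega⟩ ≤ ε := by
    have h1 : (L - ε) * (v ⟨n - 2, by omega⟩ : ℝ) ≤ ε * vn := by
      rw [div_mul_eq_mul_div, div_le_iff₀ hε₀] at hfast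
      linarith
    have h2 := mul_le_mul_of_nonneg_right hd hV.le
    have h3 : (|t₀ - y / vn| * v ⟨n - 2, by omega⟩) * vn ≤ ε * vn := by linarith
    exact le_of_mul_le_mul_right h3 hvn'
  rw [← sub_le_iff_le_add]
  refine le_trans ?_ (le_ciSup (f := fun t : ℝ => ⨅ i : Fin n, dnn (t *
    (if h : (i : ℕ) < n - 1 then (v ⟨(i : ℕ), h⟩ : ℝ) else (vn : ℝ))))
    ⟨1 / 2, ?_⟩ (y / vn))
  · haveI : Nonempty (Fin n) := ⟨⟨0, by omega⟩⟩
    refine le_ciInf fun i => ?_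
    split_ifs with h
    · have h1 : ⨅ i, dnn (t₀ * (v i : ℝ)) ≤ dnn (t₀ * v ⟨i, h⟩) :=
        ciInf_le (Set.finite_range _).bddBelow _
      have h2 := dnn_lip (t₀ * v ⟨i, h⟩) (y / vn * v ⟨i, h⟩)
      have h3 : (v ⟨i, h⟩ : ℝ) ≤ v ⟨n - 2, by omega⟩ := by
        exact_mod_cast hmono.monotone (by rw [Fin.mk_le_mk]; omega)
      rw [← sub_mul, abs_mul, Nat.abs_cast] at h2
      have h4 := mul_le_mul_of_nonneg_left h3 (abs_nonneg (t₀ - y / vn))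
      linarith
    · rw [hty]; linarith
  · rintro _ ⟨t, rfl⟩
    exact inf_le_half ⟨0, by omega⟩ _ t
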